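/- Let β, μ₀, m₀ > 0, let G be an invertible real 3×3 matrix, let I ⊂ ℝ be a compact interval, let x_s : I → ℝ³ be continuously differentiable, let Ω ⊂ ℝ³ be a bounded Lebesgue-measurable set, and let R ∈ ℝ³. Then the map u : I → ℝ defined by u(t) = −μ₀ m₀ ∫_Ω Rᵀ F̃(G(x − x_s(t))) G ẋ_s(t) dx (with F̃ extended to ξ = 0 by (β/3)·I₃) is continuous on I. -/

import Mathlib

open MeasureTheory Filter Matrix
open scoped Topology

/-- The hyperbolic cotangent `coth y = cosh y / sinh y`. -/
noncomputable def coth (y : ℝ) : ℝ := Real.cosh y / Real.sinh y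

/-- The dilated Langevin function `L_β`: `L_β z = coth (β z) - 1/(β z)` for `z ≠ 0`, `L_β 0 = 0`. -/
noncomputable def Lb (β z : ℝ) : ℝ := if z = 0 then 0 else coth (β * z) - 1 / (β * z)

/-- `L'_β z = 1/(β z²) - β/(sinh (β z))²` (the derivative of `L_β` away from `0`). -/
noncomputable def Lb' (β z : ℝ) : ℝ := 1 / (β * z ^ 2) - β / (Real.sinh (β * z)) ^ 2

/-- The Euclidean norm on `ℝ³`. -/
noncomputable def enorm3 (ξ : Fin 3 → ℝ) : ℝ := Real.sqrt (∑ i, ξ i ^ 2)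

/-- The matrix `F̃(ξ) = (L'_β(‖ξ‖)/‖ξ‖² − L_β(‖ξ‖)/‖ξ‖³)·ξξᵀ + (L_β(‖ξ‖)/‖ξ‖)·I₃` for `ξ ≠ 0`,
extended to `ξ = 0` by `(β/3)·I₃`. -/
noncomputable def Ftilde (β : ℝ) (ξ : Fin 3 → ℝ) : Matrix (Fin 3) (Fin 3) ℝ :=
  if ξ = 0 then (β / 3) • (1 : Matrix (Fin 3) (Fin 3) ℝ)
  else (Lb' β (enorm3 ξ) / (enorm3 ξ) ^ 2 - Lb β (enorm3 ξ) / (enorm3 ξ) ^ 3) •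
        Matrix.of (fun i j => ξ i * ξ j)
      + (Lb β (enorm3 ξ) / enorm3 ξ) • (1 : Matrix (Fin 3) (Fin 3) ℝ)

/-- `sinh y ≤ y cosh y` for `y ≥ 0`. -/
lemma sinh_le_mul_cosh {y : ℝ} (hy : 0 ≤ y) : Real.sinh y ≤ y * Real.cosh y := by
  have hmono : MonotoneOn (fun y => y * Real.cosh y - Real.sinh y) (Set.Ici 0) := by
    apply monotoneOn_of_deriv_nonneg (convex_Ici 0)
    · fun_prop
    · fun_prop
    · intro x hx
      rw [interior_Ici, Set.mem_Ioi] at hx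
      have h : HasDerivAt (fun y => y * Real.cosh y - Real.sinh y)
          (1 * Real.cosh x + x * Real.sinh x - Real.cosh x) x :=
        ((hasDerivAt_id x).mul (Real.hasDerivAt_cosh x)).sub (Real.hasDerivAt_sinh x)
      rw [h.deriv]
      have := mul_nonneg hx.le (Real.sinh_nonneg_iff.2 hx.le)
      linarith
  have h := hmono (Set.mem_Ici.2 le_rfl) (Set.mem_Ici.2 hy) hy
  simp only [Real.sinh_zero, zero_mul, sub_zero] at h
  linarith

/-- `cosh y ≤ 1 + y sinh y` for `y ≥ 0`. -/
lemma cosh_le_one_add_mul_sinh {y : ℝ} (hy : 0 ≤ y) :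
    Real.cosh y ≤ 1 + y * Real.sinh y := by
  obtain ⟨z, rfl⟩ : ∃ z, y = 2 * z := ⟨y / 2, by ring⟩
  have hz : 0 ≤ z := by linarith
  have hs := Real.sinh_nonneg_iff.2 hz
  have hc := (Real.cosh_pos z).le
  have h := mul_le_mul_of_nonneg_left (sinh_le_mul_cosh hz) hs
  have hzsc : 0 ≤ Real.sinh z * (z * Real.cosh z) := by positivity
  rw [Real.cosh_two_mul, Real.sinh_two_mul, Real.cosh_sq]
  nlinarith

lemma abs_Lb_le {β r : ℝ} (hβ : 0 < β) (hr : 0 < r) : |Lb β r| ≤ β * r := by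
  have hy : 0 < β * r := mul_pos hβ hr
  rw [Lb, if_neg hr.ne', coth]
  generalize β * r = y at hy ⊢
  have hs : 0 < Real.sinh y := Real.sinh_pos_iff.2 hy
  have h₁ := sinh_le_mul_cosh hy.le
  have h₂ := cosh_le_one_add_mul_sinh hy.le
  have h₃ : y ≤ Real.sinh y := Real.self_le_sinh_iff.2 hy.le
  have e : Real.cosh y / Real.sinh y - 1 / y =
      (y * Real.cosh y - Real.sinh y) / (y * Real.sinh y) := by
    field_simp
  rw [e, abs_of_nonneg (div_nonneg (by linarith) (by positivity)), div_le_iff₀ (by positivity)]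
  nlinarith

lemma abs_Lb'_le {β r : ℝ} (hβ : 0 < β) (hr : 0 < r) : |Lb' β r| ≤ β := by
  have hy : 0 < β * r := mul_pos hβ hr
  have hs : 0 < Real.sinh (β * r) := Real.sinh_pos_iff.2 hy
  have e : Lb' β r = β * ((Real.sinh (β * r) ^ 2 - (β * r) ^ 2) /
      ((β * r) ^ 2 * Real.sinh (β * r) ^ 2)) := by
    rw [Lb']
    field_simp
  rw [e]
  generalize β * r = y at hy hs ⊢
  have h₁ := pow_le_pow_left₀ hs.le (sinh_le_mul_cosh hy.le) 2
  have h₃ := pow_le_pow_left₀ hy.le (Real.self_le_sinh_iff.2 hy.le) 2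
  rw [abs_of_nonneg (mul_nonneg hβ.le (div_nonneg (by linarith) (by positivity)))]
  refine mul_le_of_le_one_right hβ.le ((div_le_one (by positivity)).2 ?_)
  rw [mul_pow, Real.cosh_sq] at h₁
  linarith

lemma enorm3_pos {ξ : Fin 3 → ℝ} (hξ : ξ ≠ 0) : 0 < enorm3 ξ := by
  obtain ⟨i, hi⟩ := Function.ne_iff.1 hξ
  exact Real.sqrt_pos.2 <| Finset.sum_pos' (fun _ _ => sq_nonneg _)
    ⟨i, Finset.mem_univ i, by simpa using sq_pos_of_ne_zero hi⟩

lemma abs_apply_le_enorm3 (ξ : Fin 3 → ℝ) (i : Fin 3) : |ξ i| ≤ enorm3 ξ :=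
  Real.abs_le_sqrt (Finset.single_le_sum (f := fun i => ξ i ^ 2) (fun _ _ => sq_nonneg _)
    (Finset.mem_univ i))

lemma abs_one_apply_le (i j : Fin 3) : |(1 : Matrix (Fin 3) (Fin 3) ℝ) i j| ≤ 1 := by
  rw [Matrix.one_apply]
  split_ifs <;> simp

lemma abs_Ftilde_apply_le {β : ℝ} (hβ : 0 < β) (ξ : Fin 3 → ℝ) (i j : Fin 3) :
    |Ftilde β ξ i j| ≤ 3 * β := by
  have h1 := abs_one_apply_le i j
  by_cases hξ : ξ = 0
  · rw [Ftilde, if_pos hξ, Matrix.smul_apply, smul_eq_mul, abs_mul, abs_of_pos (by positivity)]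
    nlinarith [abs_nonneg ((1 : Matrix (Fin 3) (Fin 3) ℝ) i j)]
  · have hr := enorm3_pos hξ
    have hi := abs_apply_le_enorm3 ξ i
    have hj := abs_apply_le_enorm3 ξ j
    have hL := abs_Lb_le hβ hr
    have hL' := abs_Lb'_le hβ hr
    rw [Ftilde, if_neg hξ]
    simp only [Matrix.add_apply, Matrix.smul_apply, Matrix.of_apply, smul_eq_mul]
    generalize enorm3 ξ = r at *
    have hq : |Lb β r / r| ≤ β := by
      rwa [abs_div, abs_of_pos hr, div_le_iff₀ hr]
    have hij : |ξ i * ξ j / r ^ 2| ≤ 1 := by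
      rw [abs_div, abs_mul, abs_of_pos (pow_pos hr 2), div_le_one (pow_pos hr 2), sq]
      exact mul_le_mul hi hj (abs_nonneg _) hr.le
    have e : (Lb' β r / r ^ 2 - Lb β r / r ^ 3) * (ξ i * ξ j) =
        (Lb' β r - Lb β r / r) * (ξ i * ξ j / r ^ 2) := by
      field_simp
    have hd : |Lb' β r - Lb β r / r| ≤ β + β := (abs_sub _ _).trans (add_le_add hL' hq)
    calc |(Lb' β r / r ^ 2 - Lb β r / r ^ 3) * (ξ i * ξ j)
            + Lb β r / r * (1 : Matrix (Fin 3) (Fin 3) ℝ) i j|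
        ≤ |(Lb' β r / r ^ 2 - Lb β r / r ^ 3) * (ξ i * ξ j)|
            + |Lb β r / r * (1 : Matrix (Fin 3) (Fin 3) ℝ) i j| := abs_add_le _ _
      _ ≤ (β + β) * 1 + β * 1 := by
          rw [e, abs_mul, abs_mul]
          gcongr
      _ = 3 * β := by ring

lemma continuous_enorm3 : Continuous enorm3 := by
  unfold enorm3
  fun_prop

lemma continuousAt_Lb {β r : ℝ} (hβ : β ≠ 0) (hr : r ≠ 0) : ContinuousAt (Lb β) r := by
  have hs : Real.sinh (β * r) ≠ 0 := Real.sinh_ne_zero.2 (mul_ne_zero hβ hr)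
  have hy : β * r ≠ 0 := mul_ne_zero hβ hr
  have h : ContinuousAt
      (fun z => Real.cosh (β * z) / Real.sinh (β * z) - 1 / (β * z)) r := by
    fun_prop (disch := assumption)
  refine h.congr ?_
  filter_upwards [isOpen_ne.mem_nhds hr] with z hz
  rw [Lb, if_neg hz, coth]

lemma continuousAt_Lb' {β r : ℝ} (hβ : β ≠ 0) (hr : r ≠ 0) : ContinuousAt (Lb' β) r := by
  have hs : Real.sinh (β * r) ^ 2 ≠ 0 := pow_ne_zero 2 (Real.sinh_ne_zero.2 (mul_ne_zero hβ hr))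
  have hy : β * r ^ 2 ≠ 0 := mul_ne_zero hβ (pow_ne_zero 2 hr)
  unfold Lb'
  fun_prop (disch := assumption)

lemma continuousAt_Ftilde_apply {β : ℝ} (hβ : β ≠ 0) {ξ : Fin 3 → ℝ} (hξ : ξ ≠ 0)
    (i j : Fin 3) : ContinuousAt (fun ξ => Ftilde β ξ i j) ξ := by
  have hr := (enorm3_pos hξ).ne'
  have hn : ContinuousAt enorm3 ξ := continuous_enorm3.continuousAt
  have hL : ContinuousAt (fun ξ => Lb β (enorm3 ξ)) ξ :=
    ContinuousAt.comp (g := Lb β) (continuousAt_Lb hβ hr) hn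
  have hL' : ContinuousAt (fun ξ => Lb' β (enorm3 ξ)) ξ :=
    ContinuousAt.comp (g := Lb' β) (continuousAt_Lb' hβ hr) hn
  have h : ContinuousAt (fun ξ : Fin 3 → ℝ =>
      (Lb' β (enorm3 ξ) / (enorm3 ξ) ^ 2 - Lb β (enorm3 ξ) / (enorm3 ξ) ^ 3) * (ξ i * ξ j)
        + Lb β (enorm3 ξ) / enorm3 ξ * (1 : Matrix (Fin 3) (Fin 3) ℝ) i j) ξ :=
    (((hL'.div (hn.pow 2) (pow_ne_zero 2 hr)).sub (hL.div (hn.pow 3) (pow_ne_zero 3 hr))).mul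
      (by fun_prop)).add ((hL.div hn hr).mul continuousAt_const)
  refine h.congr ?_
  filter_upwards [isOpen_ne.mem_nhds hξ] with η hη
  rw [Ftilde, if_neg hη]
  rfl

lemma measurable_Ftilde_apply {β : ℝ} (hβ : β ≠ 0) (i j : Fin 3) :
    Measurable (fun ξ => Ftilde β ξ i j) :=
  measurable_of_continuousOn_compl_singleton 0 fun _ hξ =>
    (continuousAt_Ftilde_apply hβ hξ i j).continuousWithinAt

/-- Continuity of the MPI signal: for `β, μ₀, m₀ > 0`, `G` invertible, a compact interval
`[a,b]`, a continuously differentiable FFP trajectory `xs` with derivative `xs'`, a bounded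
measurable `Ω ⊂ ℝ³` and `R ∈ ℝ³`, the map
`t ↦ −μ₀ m₀ ∫_Ω Rᵀ F̃(G(x − xs(t))) G xs'(t) dx` is continuous on `[a,b]`. -/
theorem mpi_signal_continuous (β μ₀ m₀ : ℝ) (hβ : 0 < β) (hμ₀ : 0 < μ₀) (hm₀ : 0 < m₀)
    (G : Matrix (Fin 3) (Fin 3) ℝ) (hG : IsUnit G.det)
    (a b : ℝ) (hab : a ≤ b) (xs xs' : ℝ → Fin 3 → ℝ)
    (hderiv : ∀ t ∈ Set.Icc a b, HasDerivWithinAt xs (xs' t) (Set.Icc a b) t)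
    (hcont : ContinuousOn xs' (Set.Icc a b))
    (Ω : Set (Fin 3 → ℝ)) (hΩb : Bornology.IsBounded Ω) (hΩm : MeasurableSet Ω)
    (R : Fin 3 → ℝ) :
    ContinuousOn (fun t =>
      -(μ₀ * m₀) * ∫ x in Ω, R ⬝ᵥ (Ftilde β (G.mulVec (x - xs t))).mulVec (G.mulVec (xs' t)))
      (Set.Icc a b) := by
  have hxs : ContinuousOn xs (Set.Icc a b) := fun t ht => (hderiv t ht).continuousWithinAt
  have hv : ContinuousOn (fun t => G.mulVec (xs' t)) (Set.Icc a b) :=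
    (Continuous.matrix_mulVec continuous_const continuous_id).comp_continuousOn hcont
  obtain ⟨C, hC⟩ := isCompact_Icc.exists_bound_of_continuousOn hv
  have hfin : IsFiniteMeasure (volume.restrict Ω) := ⟨by
    rw [Measure.restrict_apply_univ]
    exact hΩb.measure_lt_top⟩
  refine ContinuousOn.mul continuousOn_const fun t₀ ht₀ => ?_
  have hsum (A : Matrix (Fin 3) (Fin 3) ℝ) (v : Fin 3 → ℝ) :
      R ⬝ᵥ A.mulVec v = ∑ i, R i * ∑ j, A i j * v j := rfl
  simp only [hsum]
  refine continuousWithinAt_of_dominated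
    (bound := fun _ => ∑ i, |R i| * ∑ _j : Fin 3, 3 * β * C) ?_ ?_ (integrable_const _) ?_
  · refine Eventually.of_forall fun t => Measurable.aestronglyMeasurable ?_
    have hG : Measurable fun x : Fin 3 → ℝ => G.mulVec (x - xs t) :=
      (Continuous.matrix_mulVec continuous_const
        (continuous_id.sub continuous_const)).measurable
    exact Finset.measurable_fun_sum _ fun i _ => measurable_const.mul <|
      Finset.measurable_fun_sum _ fun j _ =>
        ((measurable_Ftilde_apply hβ.ne' i j).comp hG).mul measurable_const
  · filter_upwards [self_mem_nhdsWithin] with t ht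
    refine Eventually.of_forall fun x => (norm_sum_le _ _).trans (Finset.sum_le_sum fun i _ => ?_)
    rw [norm_mul, Real.norm_eq_abs]
    refine mul_le_mul_of_nonneg_left ((norm_sum_le _ _).trans
      (Finset.sum_le_sum fun j _ => ?_)) (abs_nonneg _)
    refine (norm_mul_le _ _).trans (mul_le_mul (abs_Ftilde_apply_le hβ _ i j)
      ((norm_le_pi_norm _ j).trans (hC t ht)) (norm_nonneg _) (by positivity))
  · filter_upwards [ae_restrict_of_ae (Measure.ae_ne volume (xs t₀))] with x hx
    have hne : G.mulVec (x - xs t₀) ≠ 0 := fun h =>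
      hx (sub_eq_zero.1 (Matrix.eq_zero_of_mulVec_eq_zero hG.ne_zero h))
    have hξ : ContinuousWithinAt (fun t => G.mulVec (x - xs t)) (Set.Icc a b) t₀ :=
      (Continuous.matrix_mulVec continuous_const continuous_id).continuousAt.comp_continuousWithinAt
        (continuousWithinAt_const.sub (hxs t₀ ht₀))
    refine tendsto_finsetSum _ fun i _ => Tendsto.const_mul _ <|
      tendsto_finsetSum _ fun j _ => Tendsto.mul ?_ ?_
    · exact ContinuousAt.comp_continuousWithinAt (g := fun ξ => Ftilde β ξ i j)
        (continuousAt_Ftilde_apply hβ.ne' hne i j) hξ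
    · exact (continuous_apply j).continuousAt.comp_continuousWithinAt (hv t₀ ht₀)
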